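/- For every rooted tree T, 𝒫(T;1,2) equals the number of cutsets of T. -/

import Mathlib

/-- A rooted tree: a root together with a list of branches. -/
inductive RTree : Type
  | node : List RTree → RTree

namespace RTree

/-- Number of vertices of a rooted tree. -/
def size : RTree → ℕ
  | node ts => 1 + (ts.attach.map fun t => t.1.size).sum
decreasing_by
  have := List.sizeOf_lt_of_mem t.2
  simp only [node.sizeOf_spec]
  omega

/-- The Tutte-like polynomial `𝒫(T; x, y)`, evaluated at integers `x, y`. -/
def pol : RTree → ℤ → ℤ → ℤ
  | node ts, x, y =>
    if ts.isEmpty then x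
    else (ts.attach.map fun t => pol t.1 x y).prod + y ^ ((node ts).size - 1)
decreasing_by
  have := List.sizeOf_lt_of_mem t.2
  simp only [node.sizeOf_spec]
  omega

/-- The subtree of `T` rooted at the vertex reached by following the path `p`
of child indices from the root, if such a vertex exists. -/
def subtree? : RTree → List ℕ → Option RTree
  | t, [] => some t
  | node ts, i :: p => (ts[i]?).bind fun t => subtree? t p

/-- `p` is a vertex of `T` (vertices are identified with the paths of child
indices leading to them from the root). -/
def IsVertex (T : RTree) (p : List ℕ) : Prop := (T.subtree? p).isSome

/-- `p` is a leaf of `T`: a vertex with no children. -/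
def IsLeaf (T : RTree) (p : List ℕ) : Prop := T.subtree? p = some (node [])

/-- `A` is an antichain of `T`: a set of vertices no two of which lie on a common
path from the root, i.e. no element of `A` is an ancestor (= path-prefix) of
another. -/
def IsAntichainIn (T : RTree) (A : Finset (List ℕ)) : Prop :=
  (∀ p ∈ A, T.IsVertex p) ∧ ∀ p ∈ A, ∀ q ∈ A, p ≠ q → ¬ p <+: q

/-- `A` is a maximal antichain of `T`: an antichain that is not a proper subset of
another antichain. -/
def IsMaxAntichainIn (T : RTree) (A : Finset (List ℕ)) : Prop :=
  T.IsAntichainIn A ∧ ∀ B : Finset (List ℕ), T.IsAntichainIn B → A ⊆ B → A = B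

/-- `ℓ(A)`: the number of leaves of `T` contained in `A`. -/
noncomputable def leafCount (T : RTree) (A : Finset (List ℕ)) : ℕ :=
  {p ∈ (A : Set (List ℕ)) | T.IsLeaf p}.ncard

/-- The number of vertices of the subtree `T_p` of `T` rooted at the vertex `p`
(and `0` if `p` is not a vertex). -/
def subSize (T : RTree) (p : List ℕ) : ℕ := ((T.subtree? p).map size).getD 0

/-- `s(A) = ∑_{a ∈ A} (|T_a| − 1)`: the number of vertices strictly below `A`. -/
def succCount (T : RTree) (A : Finset (List ℕ)) : ℕ := ∑ p ∈ A, (T.subSize p - 1)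

end RTree

/-- `C` is a cutset (transversal) of `T`: a set of vertices that meets every path
from the root to a leaf.  The path from the root to a leaf `q` consists of all the
ancestors of `q`, i.e. all path-prefixes of `q`. -/
def RTree.IsCutsetIn (T : RTree) (C : Finset (List ℕ)) : Prop :=
  (∀ p ∈ C, T.IsVertex p) ∧ ∀ q : List ℕ, T.IsLeaf q → ∃ p ∈ C, p <+: q

namespace RTree

/-- Structural induction: a property inherited from the branches holds for every rooted tree. -/
theorem branch_induction {P : RTree → Prop} (h : ∀ ts, (∀ t ∈ ts, P t) → P (node ts)) :
    ∀ T, P T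
  | node ts => h ts fun t _ => branch_induction h t
decreasing_by
  have := List.sizeOf_lt_of_mem ‹t ∈ ts›
  simp only [node.sizeOf_spec]
  omega

theorem size_node (ts : List RTree) : (node ts).size = 1 + (ts.map size).sum := by
  rw [size, List.attach_map_val (f := size)]

theorem pol_node (ts : List RTree) (x y : ℤ) :
    (node ts).pol x y =
      if ts = [] then x else (ts.map fun t => t.pol x y).prod + y ^ (ts.map size).sum := by
  rw [pol, List.attach_map_val (f := fun t => pol t x y), size_node, Nat.add_sub_cancel_left]
  simp [List.isEmpty_iff]

theorem isVertex_nil (T : RTree) : T.IsVertex [] := by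
  cases T
  simp [IsVertex, subtree?]

theorem isVertex_cons {ts : List RTree} {i : ℕ} {p : List ℕ} :
    (node ts).IsVertex (i :: p) ↔ ∃ h : i < ts.length, ts[i].IsVertex p := by
  by_cases h : i < ts.length <;> simp [IsVertex, subtree?, h]

theorem isLeaf_nil {ts : List RTree} : (node ts).IsLeaf [] ↔ ts = [] := by
  simp [IsLeaf, subtree?]

theorem isLeaf_cons {ts : List RTree} {i : ℕ} {p : List ℕ} :
    (node ts).IsLeaf (i :: p) ↔ ∃ h : i < ts.length, ts[i].IsLeaf p := by
  by_cases h : i < ts.length <;> simp [IsLeaf, subtree?, h]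

/-- The part of a set of paths lying in the `i`-th branch. -/
noncomputable def branchPart (i : ℕ) (C : Finset (List ℕ)) : Finset (List ℕ) :=
  C.preimage (List.cons i) (List.cons_injective.injOn)

@[simp]
theorem mem_branchPart {i : ℕ} {C : Finset (List ℕ)} {p : List ℕ} :
    p ∈ branchPart i C ↔ i :: p ∈ C := by
  simp [branchPart]

/-- The set of paths avoiding the root whose part in the `i`-th branch is `F i`. -/
def glue {n : ℕ} (F : Fin n → Finset (List ℕ)) : Finset (List ℕ) :=
  Finset.univ.biUnion fun i => (F i).image (List.cons (i : ℕ))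

theorem nil_notMem_glue {n : ℕ} (F : Fin n → Finset (List ℕ)) : [] ∉ glue F := by
  simp [glue]

theorem cons_mem_glue {n : ℕ} {F : Fin n → Finset (List ℕ)} {i : ℕ} {p : List ℕ} :
    i :: p ∈ glue F ↔ ∃ h : i < n, p ∈ F ⟨i, h⟩ := by
  simp only [glue, Finset.mem_biUnion, Finset.mem_univ, true_and, Finset.mem_image,
    List.cons.injEq]
  constructor
  · rintro ⟨j, q, hq, rfl, rfl⟩
    exact ⟨j.2, hq⟩
  · rintro ⟨h, hp⟩
    exact ⟨⟨i, h⟩, p, hp, rfl, rfl⟩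

theorem branchPart_glue {n : ℕ} (F : Fin n → Finset (List ℕ)) (i : Fin n) :
    branchPart i (glue F) = F i := by
  ext p
  simp [cons_mem_glue]

/-- Choosing a set of paths that avoids the root amounts to choosing its part in every branch
independently. -/
theorem ncard_forest {n : ℕ} (P : Fin n → Finset (List ℕ) → Prop) :
    {C : Finset (List ℕ) | [] ∉ C ∧ (∀ i p, i :: p ∈ C → i < n) ∧
      ∀ i : Fin n, P i (branchPart i C)}.ncard = ∏ i, {C | P i C}.ncard := by
  simp_rw [← Nat.card_coe_set_eq]
  rw [← Nat.card_pi]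
  refine Nat.card_congr
    { toFun := fun C i => ⟨branchPart i C.1, C.2.2.2 i⟩
      invFun := fun F => ⟨glue fun i => (F i).1, nil_notMem_glue _,
        fun i p h => (cons_mem_glue.1 h).1,
        fun i => by rw [branchPart_glue]; exact (F i).2⟩
      left_inv := ?_
      right_inv := ?_ }
  · rintro ⟨C, hnil, hlt, hC⟩
    ext p
    cases p with
    | nil => simp [hnil, nil_notMem_glue]
    | cons i p => simpa [cons_mem_glue] using hlt i p
  · intro F
    funext i
    exact Subtype.ext (branchPart_glue _ i)

/-- The sets of vertices of a rooted tree. -/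
def vertexSets (T : RTree) : Set (Finset (List ℕ)) := {C | ∀ p ∈ C, T.IsVertex p}

theorem mem_vertexSets_node {ts : List RTree} {C : Finset (List ℕ)} :
    C ∈ (node ts).vertexSets ↔ (∀ i p, i :: p ∈ C → i < ts.length) ∧
      ∀ i : Fin ts.length, branchPart i C ∈ ts[i].vertexSets := by
  simp only [vertexSets, Set.mem_ofPred_eq, mem_branchPart]
  constructor
  · intro h
    exact ⟨fun i p hp => (isVertex_cons.1 (h _ hp)).1,
      fun i p hp => (isVertex_cons.1 (h _ hp)).2⟩
  · rintro ⟨hlt, h⟩ p hp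
    cases p with
    | nil => exact isVertex_nil _
    | cons i p => exact isVertex_cons.2 ⟨hlt i p hp, h ⟨i, hlt i p hp⟩ p hp⟩

theorem isCutsetIn_node {ts : List RTree} (hts : ts ≠ []) {C : Finset (List ℕ)}
    (hC : [] ∉ C) :
    (node ts).IsCutsetIn C ↔ (∀ i p, i :: p ∈ C → i < ts.length) ∧
      ∀ i : Fin ts.length, ts[i].IsCutsetIn (branchPart i C) := by
  have hmem := mem_vertexSets_node (ts := ts) (C := C)
  simp only [vertexSets, Set.mem_ofPred_eq] at hmem
  simp only [IsCutsetIn, hmem, forall_and, and_assoc]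
  refine and_congr_right fun _ => and_congr_right fun _ => ?_
  constructor
  · intro h i q hq
    obtain ⟨p, hp, hpq⟩ := h (i :: q) (isLeaf_cons.2 ⟨i.2, hq⟩)
    cases p with
    | nil => exact absurd hp hC
    | cons j p =>
      obtain ⟨rfl, hpq'⟩ := List.cons_prefix_cons.1 hpq
      exact ⟨p, mem_branchPart.2 hp, hpq'⟩
  · intro h q hq
    cases q with
    | nil => exact absurd (isLeaf_nil.1 hq) hts
    | cons i q =>
      obtain ⟨hi, hq⟩ := isLeaf_cons.1 hq
      obtain ⟨p, hp, hpq⟩ := h ⟨i, hi⟩ q hq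
      exact ⟨i :: p, mem_branchPart.1 hp, List.cons_prefix_cons.2 ⟨rfl, hpq⟩⟩

theorem ncard_vertexSets_nil_mem (T : RTree) :
    {C ∈ T.vertexSets | [] ∈ C}.ncard = {C ∈ T.vertexSets | [] ∉ C}.ncard := by
  refine Set.ncard_congr (fun C _ => C.erase []) ?_ ?_ ?_
  · rintro C ⟨hC, -⟩
    exact ⟨fun p hp => hC p (Finset.mem_of_mem_erase hp), Finset.notMem_erase _ _⟩
  · rintro C D ⟨-, hC⟩ ⟨-, hD⟩ h
    rw [← Finset.insert_erase hC, h, Finset.insert_erase hD]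
  · rintro C ⟨hC, hnil⟩
    refine ⟨insert [] C, ⟨fun p hp => ?_, Finset.mem_insert_self _ _⟩,
      Finset.erase_insert hnil⟩
    rcases Finset.mem_insert.1 hp with rfl | hp
    · exact isVertex_nil T
    · exact hC p hp

theorem ncard_vertexSets_nil_notMem (ts : List RTree) :
    {C ∈ (node ts).vertexSets | [] ∉ C}.ncard =
      ∏ i : Fin ts.length, ts[i].vertexSets.ncard := by
  refine Eq.trans ?_ (ncard_forest fun i C => C ∈ ts[i].vertexSets)
  congr 1
  ext C
  simp only [Set.mem_ofPred_eq, mem_vertexSets_node]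
  tauto

theorem ncard_cutsets_nil_notMem {ts : List RTree} (hts : ts ≠ []) :
    {C | (node ts).IsCutsetIn C ∧ [] ∉ C}.ncard =
      ∏ i : Fin ts.length, {C | ts[i].IsCutsetIn C}.ncard := by
  rw [← ncard_forest fun i C => ts[i].IsCutsetIn C]
  congr 1
  ext C
  simp only [Set.mem_ofPred_eq, and_comm (b := [] ∉ C)]
  exact and_congr_right fun hC => isCutsetIn_node hts hC

theorem prod_two_pow_size (ts : List RTree) :
    ∏ i : Fin ts.length, 2 ^ ts[i].size = 2 ^ (ts.map size).sum := by
  rw [Finset.prod_pow_eq_pow_sum]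
  congr 1
  exact Fin.sum_univ_fun_getElem ts size

theorem finite_vertexSets_and_ncard (T : RTree) :
    T.vertexSets.Finite ∧ T.vertexSets.ncard = 2 ^ T.size := by
  induction T using branch_induction with
  | h ts ih =>
    have hout : {C ∈ (node ts).vertexSets | [] ∉ C}.ncard = 2 ^ (ts.map size).sum := by
      rw [ncard_vertexSets_nil_notMem, ← prod_two_pow_size]
      exact Finset.prod_congr rfl fun i _ => (ih _ (List.getElem_mem _)).2
    have hin := (ncard_vertexSets_nil_mem (node ts)).trans hout
    have hfout := Set.finite_of_ncard_ne_zero (hout.trans_ne (by positivity))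
    have hfin := Set.finite_of_ncard_ne_zero (hin.trans_ne (by positivity))
    have hunion : (node ts).vertexSets =
        {C ∈ (node ts).vertexSets | [] ∈ C} ∪ {C ∈ (node ts).vertexSets | [] ∉ C} := by
      ext C
      simp only [Set.mem_union, Set.mem_ofPred_eq]
      tauto
    have hdisj : Disjoint {C ∈ (node ts).vertexSets | [] ∈ C}
        {C ∈ (node ts).vertexSets | [] ∉ C} :=
      Set.disjoint_left.2 fun C h h' => h'.2 h.2
    refine ⟨hunion ▸ hfin.union hfout, ?_⟩
    rw [hunion, Set.ncard_union_eq hdisj hfin hfout, hin, hout, size_node]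
    ring

theorem ncard_cutsets (ts : List RTree) :
    {C | (node ts).IsCutsetIn C}.ncard =
      {C | (node ts).IsCutsetIn C ∧ [] ∉ C}.ncard + 2 ^ (ts.map size).sum := by
  have hfin := (finite_vertexSets_and_ncard (node ts)).1
  have hin : {C ∈ (node ts).vertexSets | [] ∈ C}.ncard = 2 ^ (ts.map size).sum := by
    rw [ncard_vertexSets_nil_mem, ncard_vertexSets_nil_notMem, ← prod_two_pow_size]
    exact Finset.prod_congr rfl fun i _ => (finite_vertexSets_and_ncard _).2
  rw [← hin, ← Set.ncard_union_eq (Set.disjoint_left.2 fun C h h' => h.2 h'.2)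
    (hfin.subset fun C h => h.1.1) (hfin.subset fun C h => h.1)]
  congr 1
  ext C
  simp only [Set.mem_union, Set.mem_ofPred_eq]
  constructor
  · intro h
    by_cases hC : [] ∈ C
    · exact Or.inr ⟨h.1, hC⟩
    · exact Or.inl ⟨h, hC⟩
  · rintro (h | h)
    · exact h.1
    · exact ⟨h.1, fun q _ => ⟨[], h.2, List.nil_prefix⟩⟩

theorem not_isCutsetIn_node_nil {C : Finset (List ℕ)} (hC : [] ∉ C) :
    ¬ (node []).IsCutsetIn C := by
  intro h
  obtain ⟨p, hp, hpq⟩ := h.2 [] (isLeaf_nil.2 rfl)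
  exact hC (List.prefix_nil.1 hpq ▸ hp)

end RTree

/-- For every rooted tree `T`, `𝒫(T;1,2)` equals the number of
cutsets of `T`. -/
theorem pol_one_two (T : RTree) :
    T.pol 1 2 = {C : Finset (List ℕ) | T.IsCutsetIn C}.ncard := by
  induction T using RTree.branch_induction with
  | h ts ih =>
    rw [RTree.pol_node, RTree.ncard_cutsets]
    split_ifs with hts
    · subst hts
      have : {C | (RTree.node []).IsCutsetIn C ∧ [] ∉ C} = ∅ :=
        Set.eq_empty_of_forall_notMem fun C h => RTree.not_isCutsetIn_node_nil h.2 h.1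
      simp [this]
    · rw [RTree.ncard_cutsets_nil_notMem hts, ← Fin.prod_univ_fun_getElem]
      push_cast
      congr 1
      exact Finset.prod_congr rfl fun i _ => ih _ (List.getElem_mem _)
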